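/- Let P = P_{n,r} be the poset of r-colored injective words with the natural 𝔖_n-action, and for T ⊆ {1,…,n} let b_{r,λ}(T) denote the multiplicity of the irreducible 𝔖_n-representation ρ^λ in β_P(T). Then for every S ⊆ {1,…,n−1} and every partition λ of n, b_{r,λ}(S) + b_{r,λ}(S ∪ {n}) = b_n(S) · r^n · f^λ, where f^λ is the number of standard Young tableaux of shape λ and b_n(S) is the number of permutations in 𝔖_n with descent set S. -/

import Mathlib

open scoped Classical

noncomputable section

/-! ### Permutation combinatorics -/

/-- The value `w(i)` (1-based, in `{1,…,n}`) of a permutation `w` of `{1,…,n}`,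
realized as `Equiv.Perm (Fin n)`. -/
def permApp {n : ℕ} (w : Equiv.Perm (Fin n)) (i : ℕ) : ℕ :=
  if h : i - 1 < n then (w ⟨i - 1, h⟩ : ℕ) + 1 else 0

/-- The descent set of a permutation, a subset of `{1,…,n-1}`. -/
def descentSet {n : ℕ} (w : Equiv.Perm (Fin n)) : Finset ℕ :=
  (Finset.Icc 1 (n - 1)).filter fun i => permApp w (i + 1) < permApp w i

/-- `numDescentSet m T` is the number of permutations in `𝔖_m` with descent set `T`. -/
def numDescentSet (m : ℕ) (T : Finset ℕ) : ℕ :=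
  Nat.card {w : Equiv.Perm (Fin m) // descentSet w = T}

/-- The Coxeter length (number of inversions) of a permutation. -/
def invCount {n : ℕ} (w : Equiv.Perm (Fin n)) : ℕ :=
  (Finset.univ.filter fun p : Fin n × Fin n => p.1 < p.2 ∧ w p.2 < w p.1).card

/-- For `S = {s_1 < s_2 < ⋯ < s_k} ⊆ {1,…,n-1}`, `sElt n S j = s_j`, with the
conventions `s_0 = 0` and `s_j = n` for `j > k`. -/
def sElt (n : ℕ) (S : Finset ℕ) (j : ℕ) : ℕ :=
  if j = 0 then 0 else if j ≤ S.card then (S.sort (· ≤ ·)).getD (j - 1) 0 else n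

lemma sElt_of_gt (n : ℕ) (S : Finset ℕ) (j : ℕ) (h : S.card < j) : sElt n S j = n := by
  unfold sElt
  rw [if_neg (by omega), if_neg (by omega)]

/-! ### Standard Young tableaux -/

/-- A standard Young tableau of shape `μ`: a filling of the cells of `μ` by the numbers
`1,…,μ.card`, each used once, strictly increasing along rows and columns
(the entry of a non-cell is `0`). -/
structure SYT (μ : YoungDiagram) where
  entry : ℕ → ℕ → ℕ
  entry_eq_zero : ∀ i j, (i, j) ∉ μ → entry i j = 0
  row_strict : ∀ i j1 j2, j1 < j2 → (i, j2) ∈ μ → entry i j1 < entry i j2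
  col_strict : ∀ i1 i2 j, i1 < i2 → (i2, j) ∈ μ → entry i1 j < entry i2 j
  bijOn : Set.BijOn (fun p : ℕ × ℕ => entry p.1 p.2) ↑μ.cells ↑(Finset.Icc 1 μ.card)

/-- The descent set of a standard Young tableau: those `k` such that `k+1` lies in a
strictly lower row than `k`. -/
def SYT.des {μ : YoungDiagram} (Q : SYT μ) : Finset ℕ :=
  (Finset.Icc 1 (μ.card - 1)).filter fun k =>
    ∃ p1 ∈ μ.cells, ∃ p2 ∈ μ.cells,
      Q.entry p1.1 p1.2 = k ∧ Q.entry p2.1 p2.2 = k + 1 ∧ p1.1 < p2.1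

/-- `fSYTRow μ t` is the number of standard Young tableaux of shape `μ` whose first row
contains the numbers `1,…,t`. -/
def fSYTRow (μ : YoungDiagram) (t : ℕ) : ℕ :=
  Nat.card {Q : SYT μ // ∀ k, 1 ≤ k → k ≤ t → ∃ j, (0, j) ∈ μ ∧ Q.entry 0 j = k}

/-! ### Irreducible characters of the symmetric group, via Jacobi–Trudi -/

/-- The number of functions `f : Fin n → Fin k` which are invariant under `g` and whose
fiber over `i` has `c i` elements.  For `c` a composition of `n`, the function
`g ↦ fixedYoungFns n k c g` is the character of the permutation representation of `𝔖_n`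
on ordered set partitions of `{1,…,n}` of type `c`, i.e. of the representation induced
from the trivial representation of the corresponding Young subgroup. -/
def fixedYoungFns (n k : ℕ) (c : Fin k → ℤ) (g : Equiv.Perm (Fin n)) : ℕ :=
  Nat.card {f : Fin n → Fin k //
    (∀ x, f (g x) = f x) ∧ ∀ i, ((Nat.card {x : Fin n // f x = i} : ℕ) : ℤ) = c i}

/-- The irreducible character `χ^μ` of `𝔖_n` associated to a partition `μ` of `n`
(encoded as a Young diagram with `n` cells), defined through the Jacobi–Trudi
determinantal formula `χ^μ = det (h_{μ_i - i + j})`. -/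
def chi (n : ℕ) (μ : YoungDiagram) (g : Equiv.Perm (Fin n)) : ℤ :=
  ∑ σ : Equiv.Perm (Fin μ.rowLens.length),
    ((Equiv.Perm.sign σ : ℤˣ) : ℤ) *
      (fixedYoungFns n μ.rowLens.length
        (fun i => ((μ.rowLen (i : ℕ) : ℕ) : ℤ) - ((i : ℕ) : ℤ) + ((σ i : ℕ) : ℤ)) g : ℤ)

/-! ### Posets, rank selection, maximal chains and characters -/

/-- The maximal chains of the subposet induced on a subset `A` of a poset. -/
def maxChainsIn {P : Type*} [Preorder P] (A : Set P) : Set (Set P) :=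
  {C | C ⊆ A ∧ IsChain (· ≤ ·) C ∧
    ∀ D : Set P, D ⊆ A → IsChain (· ≤ ·) D → C ⊆ D → C = D}

/-- The rank-selected subposet `P_S = {x ∈ P : rk x ∈ S} ∪ {⊥, ⊤}`. -/
def rankSel {P : Type*} [Preorder P] [OrderBot P] [OrderTop P] (rk : P → ℕ)
    (S : Finset ℕ) : Set P :=
  {x | rk x ∈ S} ∪ {⊥, ⊤}

/-- `a_P(S)`: the number of maximal chains of the rank-selected subposet `P_S`. -/
def chainCount {P : Type*} [Preorder P] [OrderBot P] [OrderTop P] (rk : P → ℕ)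
    (S : Finset ℕ) : ℕ :=
  Set.ncard (maxChainsIn (rankSel rk S))

/-- `b_P(S) = Σ_{T ⊆ S} (-1)^{|S-T|} a_P(T)`. -/
def bDim {P : Type*} [Preorder P] [OrderBot P] [OrderTop P] (rk : P → ℕ)
    (S : Finset ℕ) : ℤ :=
  ∑ T ∈ S.powerset, (-1 : ℤ) ^ (S.card - T.card) * (chainCount rk T : ℤ)

/-- The character of the permutation representation `α_P(S)` of a group `G` acting (via
`act`) on the maximal chains of the rank-selected subposet `P_S`: its value at `g` is
the number of maximal chains of `P_S` fixed by `g`. -/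
def gAlpha {P G : Type*} [Preorder P] [OrderBot P] [OrderTop P] (rk : P → ℕ)
    (act : G → P → P) (S : Finset ℕ) (g : G) : ℤ :=
  (Set.ncard {C : Set P | C ∈ maxChainsIn (rankSel rk S) ∧ act g '' C = C} : ℤ)

/-- The character of the virtual representation
`β_P(S) = Σ_{T ⊆ S} (-1)^{|S-T|} α_P(T)`. -/
def gBeta {P G : Type*} [Preorder P] [OrderBot P] [OrderTop P] (rk : P → ℕ)
    (act : G → P → P) (S : Finset ℕ) (g : G) : ℤ :=
  ∑ T ∈ S.powerset, (-1 : ℤ) ^ (S.card - T.card) * gAlpha rk act T g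

/-! ### The poset of injective words -/

/-- An injective word over the alphabet `{1,…,n}`. -/
def InjWord (n : ℕ) : Type := {l : List (Fin n) // l.Nodup}

instance (n : ℕ) : PartialOrder (InjWord n) where
  le u v := u.1.Sublist v.1
  le_refl u := List.Sublist.refl _
  le_trans u v w h1 h2 := List.Sublist.trans h1 h2
  le_antisymm u v h1 h2 := Subtype.ext (List.Sublist.antisymm h1 h2)

instance (n : ℕ) : OrderBot (InjWord n) where
  bot := ⟨[], List.nodup_nil⟩
  bot_le u := List.nil_sublist u.1

/-- The rank function of the poset of injective words (with a maximum adjoined):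
the rank of a word is its length, and the rank of `⊤` is `n+1`. -/
def rkInj (n : ℕ) (x : WithTop (InjWord n)) : ℕ :=
  WithTop.recTopCoe (n + 1) (fun u => u.1.length) x

/-- The action of `𝔖_n` on injective words, letter by letter. -/
def permWord {n : ℕ} (w : Equiv.Perm (Fin n)) (u : InjWord n) : InjWord n :=
  ⟨u.1.map w, u.2.map w.injective⟩

/-- The character of `α_{P_n}(S)` for the `𝔖_n`-action on the poset of injective words. -/
def injAlpha (n : ℕ) (S : Finset ℕ) (g : Equiv.Perm (Fin n)) : ℤ :=
  gAlpha (rkInj n) (fun w : Equiv.Perm (Fin n) => WithTop.map (permWord w)) S g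

/-- The character of `β_{P_n}(S)` for the `𝔖_n`-action on the poset of injective words. -/
def injBeta (n : ℕ) (S : Finset ℕ) (g : Equiv.Perm (Fin n)) : ℤ :=
  gBeta (rkInj n) (fun w : Equiv.Perm (Fin n) => WithTop.map (permWord w)) S g

/-! ### The poset of r-colored injective words -/

/-- An `r`-colored injective word over `{1,…,n}`: a word in the alphabet
`{1,…,n} × ℤ_r` whose letters have pairwise distinct first coordinates. -/
def CInjWord (n r : ℕ) : Type := {l : List (Fin n × ZMod r) // (l.map Prod.fst).Nodup}

instance (n r : ℕ) : PartialOrder (CInjWord n r) where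
  le u v := u.1.Sublist v.1
  le_refl u := List.Sublist.refl _
  le_trans u v w h1 h2 := List.Sublist.trans h1 h2
  le_antisymm u v h1 h2 := Subtype.ext (List.Sublist.antisymm h1 h2)

instance (n r : ℕ) : OrderBot (CInjWord n r) where
  bot := ⟨[], by simp⟩
  bot_le u := List.nil_sublist u.1

/-- The rank function of the poset `P_{n,r}` of `r`-colored injective words
(with a maximum adjoined). -/
def rkC (n r : ℕ) (x : WithTop (CInjWord n r)) : ℕ :=
  WithTop.recTopCoe (n + 1) (fun u => u.1.length) x

/-- The action of `𝔖_n` on `r`-colored injective words: act on the first coordinate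
of each letter, leaving colors unchanged. -/
def permCWord {n r : ℕ} (w : Equiv.Perm (Fin n)) (u : CInjWord n r) : CInjWord n r :=
  ⟨u.1.map (fun p => (w p.1, p.2)), by
    have h := u.2.map w.injective
    rw [List.map_map] at h ⊢
    exact h⟩

/-- The character of `α_{P_{n,r}}(S)`. -/
def cAlpha (n r : ℕ) (S : Finset ℕ) (g : Equiv.Perm (Fin n)) : ℤ :=
  gAlpha (rkC n r) (fun w : Equiv.Perm (Fin n) => WithTop.map (permCWord w)) S g

/-- The character of `β_{P_{n,r}}(S)`. -/
def cBeta (n r : ℕ) (S : Finset ℕ) (g : Equiv.Perm (Fin n)) : ℤ :=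
  gBeta (rkC n r) (fun w : Equiv.Perm (Fin n) => WithTop.map (permCWord w)) S g

/-- `b_{P_{n,r}}(S)`, the dimension of `β_{P_{n,r}}(S)`. -/
def cChainDim (n r : ℕ) (S : Finset ℕ) : ℤ := bDim (rkC n r) S

/-! ### The statistics τ -/

/-- `τ(w,Q)` for a permutation `w` with descent set `S = {s_1 < ⋯ < s_k}` and a standard
Young tableau `Q`: the largest `i ∈ {0,…,k+1}` such that (a) `w(x) = w_S(x)` for
`x > s_{k+1-i}` and (b) no descent of `Q` is smaller than `n - s_{k+1-i}`. -/
def tau (n : ℕ) (S : Finset ℕ) (wS w : Equiv.Perm (Fin n)) {μ : YoungDiagram}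
    (Q : SYT μ) : ℕ :=
  ((Finset.range (S.card + 2)).filter
    (fun i => (∀ x, sElt n S (S.card + 1 - i) < x → x ≤ n → permApp w x = permApp wS x) ∧
      (∀ d ∈ Q.des, n - sElt n S (S.card + 1 - i) ≤ d))).max'
    ⟨0, by
      have hs := sElt_of_gt n S (S.card + 1 - 0) (by omega)
      refine Finset.mem_filter.2 ⟨Finset.mem_range.2 (by omega), ?_, ?_⟩
      · intro x hx hx'
        rw [hs] at hx
        exact absurd hx (not_lt.2 hx')
      · intro d _
        rw [hs]
        omega⟩

/-- The condition that all the numbers `1,…,t` appear in the first row of the `r`-colored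
standard Young tableau `(Q, c)` and are colored with the zero color (the color of the
entry `k` being `c (k-1)`). -/
def zeroFirstRow {μ : YoungDiagram} {r : ℕ} (Q : SYT μ) (c : Fin μ.card → ZMod r)
    (t : ℕ) : Prop :=
  ∀ k : Fin μ.card, (k : ℕ) < t →
    ((∃ j, (0, j) ∈ μ ∧ Q.entry 0 j = (k : ℕ) + 1) ∧ c k = 0)

/-- `τ(w,Q)` for an `r`-colored standard Young tableau `(Q,c)`. -/
def ctau (n : ℕ) {r : ℕ} (S : Finset ℕ) (wS w : Equiv.Perm (Fin n)) {μ : YoungDiagram}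
    (Q : SYT μ) (c : Fin μ.card → ZMod r) : ℕ :=
  ((Finset.range (S.card + 2)).filter
    (fun i => (∀ x, sElt n S (S.card + 1 - i) < x → x ≤ n → permApp w x = permApp wS x) ∧
      zeroFirstRow Q c (n - sElt n S (S.card + 1 - i)))).max'
    ⟨0, by
      have hs := sElt_of_gt n S (S.card + 1 - 0) (by omega)
      refine Finset.mem_filter.2 ⟨Finset.mem_range.2 (by omega), ?_, ?_⟩
      · intro x hx hx'
        rw [hs] at hx
        exact absurd hx (not_lt.2 hx')
      · rw [hs]
        intro k hk
        exact absurd hk (by omega)⟩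

/-- The largest `i ∈ {0,…,n}` such that all the numbers `1,…,i` appear in the first row
of the `r`-colored standard Young tableau `(Q,c)` and are colored with the zero color. -/
def mQ (n : ℕ) {r : ℕ} {μ : YoungDiagram} (Q : SYT μ) (c : Fin μ.card → ZMod r) : ℕ :=
  ((Finset.range (n + 1)).filter (fun i => zeroFirstRow Q c i)).max'
    ⟨0, Finset.mem_filter.2 ⟨Finset.mem_range.2 (by omega),
      fun k hk => absurd hk (by omega)⟩⟩

/-- The condition, for an `r`-colored permutation `(π, c)` (the color of the entry
`π(x)` in one-line notation being `c (x-1)`), that the entries `π(1),…,π(t)` are in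
increasing order and all colored with the zero color. -/
def zeroIncreasing {n r : ℕ} (π : Equiv.Perm (Fin n)) (c : Fin n → ZMod r) (t : ℕ) : Prop :=
  (∀ x y, 1 ≤ x → x < y → y ≤ t → permApp π x < permApp π y) ∧
  ∀ k : Fin n, (k : ℕ) < t → c k = 0

/-- `τ(w,u)` for an `r`-colored permutation `u = (π, c)`. -/
def tauU (n : ℕ) {r : ℕ} (S : Finset ℕ) (wS w : Equiv.Perm (Fin n))
    (π : Equiv.Perm (Fin n)) (c : Fin n → ZMod r) : ℕ :=
  ((Finset.range (S.card + 2)).filter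
    (fun i => (∀ x, sElt n S (S.card + 1 - i) < x → x ≤ n → permApp w x = permApp wS x) ∧
      zeroIncreasing π c (n - sElt n S (S.card + 1 - i)))).max'
    ⟨0, by
      have hs := sElt_of_gt n S (S.card + 1 - 0) (by omega)
      refine Finset.mem_filter.2 ⟨Finset.mem_range.2 (by omega), ?_, ?_, ?_⟩
      · intro x hx hx'
        rw [hs] at hx
        exact absurd hx (not_lt.2 hx')
      · intro x y hx hxy hy
        rw [hs] at hy
        exact absurd hy (by omega)
      · rw [hs]
        intro k hk
        exact absurd hk (by omega)⟩

/-- The largest `i ∈ {0,…,n}` such that the entries `π(1),…,π(i)` of the `r`-colored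
permutation `(π,c)` are in increasing order and all colored with the zero color. -/
def mU (n : ℕ) {r : ℕ} (π : Equiv.Perm (Fin n)) (c : Fin n → ZMod r) : ℕ :=
  ((Finset.range (n + 1)).filter (fun i => zeroIncreasing π c i)).max'
    ⟨0, Finset.mem_filter.2 ⟨Finset.mem_range.2 (by omega),
      fun x y hx hxy hy => absurd hy (by omega),
      fun k hk => absurd hk (by omega)⟩⟩

/-- `a_m(T)`: the number of chains in the Boolean lattice `B_m` whose elements have
set of ranks (cardinalities) equal to `T`. -/
def boolChains (m : ℕ) (T : Finset ℕ) : ℕ :=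
  Nat.card {c : Finset (Finset (Fin m)) //
    IsChain (· ⊆ ·) (↑c : Set (Finset (Fin m))) ∧ c.image Finset.card = T}

end

noncomputable section
/-! ### Part A : determinant recursion -/

/-- Number of functions with prescribed fiber sizes. -/
def multiN (k n : ℕ) (c : Fin k → ℤ) : ℤ :=
  ∑ f : Fin n → Fin k,
    if ∀ i, (((Finset.univ.filter fun x => f x = i).card : ℕ) : ℤ) = c i then 1 else 0

/-- The Jacobi-Trudi alternating sum. -/
def detD (k n : ℕ) (v : Fin k → ℤ) : ℤ :=
  ∑ σ : Equiv.Perm (Fin k), ((Equiv.Perm.sign σ : ℤˣ) : ℤ) *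
    multiN k n (fun i => v i + ((σ i : ℕ) : ℤ))

lemma fixedYoungFns_one (n k : ℕ) (c : Fin k → ℤ) :
    (fixedYoungFns n k c 1 : ℤ) = multiN k n c := by
  unfold fixedYoungFns multiN
  rw [Nat.card_eq_fintype_card, Fintype.card_subtype, Finset.card_filter]
  push_cast
  refine Finset.sum_congr rfl fun f _ => ?_
  have : ∀ i, Nat.card {x : Fin n // f x = i} = (Finset.univ.filter fun x => f x = i).card := by
    intro i
    rw [Nat.card_eq_fintype_card, Fintype.card_subtype]
  simp only [this]
  simp

lemma chi_one (n : ℕ) (μ : YoungDiagram) :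
    chi n μ 1 = detD μ.rowLens.length n
      (fun i => ((μ.rowLen (i : ℕ) : ℕ) : ℤ) - ((i : ℕ) : ℤ)) := by
  unfold chi detD
  simp only [fixedYoungFns_one]

lemma multiN_succ (k n : ℕ) (c : Fin k → ℤ) :
    multiN k (n + 1) c = ∑ i, multiN k n (fun j => c j - if j = i then 1 else 0) := by
  unfold multiN
  rw [← (Fin.consEquiv (fun _ => Fin k)).sum_comp, Fintype.sum_prod_type]
  refine Finset.sum_congr rfl fun a _ => Finset.sum_congr rfl fun f _ => ?_
  congr 1
  apply propext
  refine forall_congr' fun i => ?_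
  rw [Fin.card_filter_univ_succ]
  by_cases h : a = i
  · subst h
    simp [Fin.consEquiv]
    constructor <;> intro h <;> linarith
  · simp [Fin.consEquiv, h, Ne.symm h]

lemma detD_succ (k n : ℕ) (v : Fin k → ℤ) :
    detD k (n + 1) v = ∑ i, detD k n (fun j => v j - if j = i then 1 else 0) := by
  unfold detD
  rw [Finset.sum_comm]
  refine Finset.sum_congr rfl fun σ _ => ?_
  rw [multiN_succ, Finset.mul_sum]
  refine Finset.sum_congr rfl fun i _ => ?_
  congr 2
  ext j
  ring

lemma multiN_perm (k n : ℕ) (c : Fin k → ℤ) (τ : Equiv.Perm (Fin k)) :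
    multiN k n (c ∘ τ) = multiN k n c := by
  unfold multiN
  conv_rhs => rw [← (Equiv.arrowCongr (Equiv.refl (Fin n)) τ).sum_comp]
  refine Finset.sum_congr rfl fun f _ => ?_
  congr 1
  apply propext
  conv_rhs => rw [← τ.forall_congr_right]
  simp [Equiv.arrowCongr]

lemma detD_eq_zero (k n : ℕ) (v : Fin k → ℤ) (a b : Fin k) (hab : a ≠ b) (hv : v a = v b) :
    detD k n v = 0 := by
  have h : detD k n v = - detD k n v := by
    conv_lhs => unfold detD
    rw [← Equiv.sum_comp (Equiv.mulRight (Equiv.swap a b))]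
    unfold detD
    rw [← Finset.sum_neg_distrib]
    refine Finset.sum_congr rfl fun σ _ => ?_
    have h2 : (fun i => v i + (((σ * Equiv.swap a b) i : ℕ) : ℤ)) =
        (fun i => v i + ((σ i : ℕ) : ℤ)) ∘ (Equiv.swap a b) := by
      ext i
      simp only [Function.comp, Equiv.Perm.mul_apply]
      congr 1
      by_cases h1 : i = a
      · subst h1; simp [hv]
      · by_cases h3 : i = b
        · subst h3; simp [hv]
        · rw [Equiv.swap_apply_of_ne_of_ne h1 h3]
    simp only [Equiv.coe_mulRight]
    rw [h2, multiN_perm, Equiv.Perm.sign_mul, Equiv.Perm.sign_swap hab]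
    simp
  linarith

lemma multiN_neg (k n : ℕ) (c : Fin k → ℤ) (i : Fin k) (hi : c i < 0) : multiN k n c = 0 := by
  unfold multiN
  refine Finset.sum_eq_zero fun f _ => ?_
  rw [if_neg]
  intro h
  have := h i
  omega

lemma detD_neg (k n : ℕ) (v : Fin k → ℤ) (i : Fin k) (hi : v i + k ≤ 0) : detD k n v = 0 := by
  unfold detD
  refine Finset.sum_eq_zero fun σ _ => ?_
  rw [multiN_neg k n _ i, mul_zero]
  have := (σ i).2
  omega

lemma detD_zero (k : ℕ) : detD k 0 (fun i => - ((i : ℕ) : ℤ)) = 1 := by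
  unfold detD
  rw [Finset.sum_eq_single 1]
  · simp [multiN]
  · intro σ _ hσ
    have : multiN k 0 (fun i => - ((i : ℕ) : ℤ) + ((σ i : ℕ) : ℤ)) = 0 := by
      unfold multiN
      refine Finset.sum_eq_zero fun f _ => ?_
      rw [if_neg]
      intro h
      apply hσ
      ext i
      have := h i
      simp at this
      simp
      omega
    rw [this, mul_zero]
  · simp

/-! ### Part B : standard Young tableaux -/

lemma SYT.ext' {μ : YoungDiagram} {Q R : SYT μ}
    (h : ∀ i j, (i, j) ∈ μ → Q.entry i j = R.entry i j) : Q = R := by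
  have h2 : Q.entry = R.entry := by
    ext i j
    by_cases hij : (i, j) ∈ μ
    · exact h i j hij
    · rw [Q.entry_eq_zero i j hij, R.entry_eq_zero i j hij]
  cases Q; cases R; cases h2; rfl

lemma SYT.entry_mem {μ : YoungDiagram} (Q : SYT μ) {i j : ℕ} (h : (i, j) ∈ μ) :
    1 ≤ Q.entry i j ∧ Q.entry i j ≤ μ.card := by
  have := Q.bijOn.mapsTo (show ((i, j) : ℕ × ℕ) ∈ (↑μ.cells : Set (ℕ × ℕ)) from h)
  simpa using this

instance SYT.finite (μ : YoungDiagram) : Finite (SYT μ) := by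
  refine Finite.of_injective
    (fun (Q : SYT μ) (p : μ.cells) =>
      (⟨Q.entry p.1.1 p.1.2, Nat.lt_succ_of_le (Q.entry_mem (i := p.1.1) (j := p.1.2) p.2).2⟩ :
        Fin (μ.card + 1))) ?_
  intro Q R h
  refine SYT.ext' fun i j hij => ?_
  have := congrFun h ⟨(i, j), hij⟩
  simpa using this

/-- Remove the last cell of row `i` when this is a corner. -/
def remCorner (μ : YoungDiagram) (i : ℕ) (h : μ.rowLen (i + 1) < μ.rowLen i) : YoungDiagram where
  cells := μ.cells.erase (i, μ.rowLen i - 1)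
  isLowerSet := by
    rintro ⟨a, b⟩ ⟨c, d⟩ hle hab
    simp only [Finset.coe_erase, Set.mem_sdiff, Finset.mem_coe, Set.mem_singleton_iff] at hab ⊢
    obtain ⟨h1, h2⟩ := hab
    have hle' : c ≤ a ∧ d ≤ b := hle
    refine ⟨μ.isLowerSet hle h1, ?_⟩
    rintro h3
    apply h2
    rw [Prod.mk.injEq] at h3 ⊢
    obtain ⟨rfl, rfl⟩ := h3
    have hb : b < μ.rowLen a := YoungDiagram.mem_iff_lt_rowLen.1 h1
    have hac : a = c := by
      by_contra hne
      have : μ.rowLen a ≤ μ.rowLen (c + 1) := μ.rowLen_anti _ _ (by omega)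
      omega
    subst hac
    omega

lemma mem_remCorner (μ : YoungDiagram) (i : ℕ) (h : μ.rowLen (i + 1) < μ.rowLen i) (p : ℕ × ℕ) :
    p ∈ remCorner μ i h ↔ p ≠ (i, μ.rowLen i - 1) ∧ p ∈ μ := by
  rw [← YoungDiagram.mem_cells]
  simp [remCorner]

lemma corner_mem (μ : YoungDiagram) (i : ℕ) (h : μ.rowLen (i + 1) < μ.rowLen i) :
    (i, μ.rowLen i - 1) ∈ μ := by
  rw [YoungDiagram.mem_iff_lt_rowLen]; omega

lemma card_remCorner (μ : YoungDiagram) (i : ℕ) (h : μ.rowLen (i + 1) < μ.rowLen i) :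
    (remCorner μ i h).card = μ.card - 1 := by
  have := corner_mem μ i h
  rw [← YoungDiagram.mem_cells] at this
  simp [YoungDiagram.card, remCorner, Finset.card_erase_of_mem this]

lemma rowLen_remCorner (μ : YoungDiagram) (i : ℕ) (h : μ.rowLen (i + 1) < μ.rowLen i) (j : ℕ) :
    (remCorner μ i h).rowLen j = μ.rowLen j - if j = i then 1 else 0 := by
  refine eq_of_forall_lt_iff fun c => ?_
  rw [← YoungDiagram.mem_iff_lt_rowLen, mem_remCorner, YoungDiagram.mem_iff_lt_rowLen]
  by_cases hj : j = i
  · subst hj; simp; omega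
  · simp [hj]

lemma corner_card_pos (μ : YoungDiagram) (i : ℕ) (h : μ.rowLen (i + 1) < μ.rowLen i) :
    0 < μ.card := Finset.card_pos.2 ⟨_, corner_mem μ i h⟩

/-- Restrict a tableau whose largest entry is at the corner. -/
def SYT.restrict {μ : YoungDiagram} (i : ℕ) (h : μ.rowLen (i + 1) < μ.rowLen i) (Q : SYT μ)
    (hQ : Q.entry i (μ.rowLen i - 1) = μ.card) : SYT (remCorner μ i h) where
  entry a b := if (a, b) ∈ remCorner μ i h then Q.entry a b else 0
  entry_eq_zero a b hab := if_neg hab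
  row_strict a b c hbc hm := by
    have : (a, b) ∈ remCorner μ i h := (remCorner μ i h).up_left_mem le_rfl hbc.le hm
    rw [if_pos this, if_pos hm]
    exact Q.row_strict _ _ _ hbc ((mem_remCorner _ _ _ _).1 hm).2
  col_strict a b c hbc hm := by
    have : (a, c) ∈ remCorner μ i h := (remCorner μ i h).up_left_mem hbc.le le_rfl hm
    rw [if_pos this, if_pos hm]
    exact Q.col_strict _ _ _ hbc ((mem_remCorner _ _ _ _).1 hm).2
  bijOn := by
    rw [card_remCorner]
    have hpos := corner_card_pos μ i h
    refine ⟨?_, ?_, ?_⟩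
    · rintro ⟨a, b⟩ hab
      have hab' : (a, b) ∈ remCorner μ i h := hab
      have h2 := (mem_remCorner _ _ _ _).1 hab'
      have h3 := Q.entry_mem h2.2
      have h4 : Q.entry a b ≠ μ.card := by
        intro h5
        exact h2.1 (Q.bijOn.injOn h2.2 (corner_mem μ i h) (h5.trans hQ.symm))
      simp only [if_pos hab', Finset.coe_Icc, Set.mem_Icc]
      omega
    · rintro ⟨a, b⟩ hab ⟨c, d⟩ hcd heq
      have hab' : (a, b) ∈ remCorner μ i h := hab
      have hcd' : (c, d) ∈ remCorner μ i h := hcd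
      simp only [if_pos hab', if_pos hcd'] at heq
      exact Q.bijOn.injOn ((mem_remCorner _ _ _ _).1 hab').2 ((mem_remCorner _ _ _ _).1 hcd').2 heq
    · intro m hm
      simp only [Finset.coe_Icc, Set.mem_Icc] at hm
      obtain ⟨⟨a, b⟩, hab, hm2⟩ := Q.bijOn.surjOn (show m ∈ (↑(Finset.Icc 1 μ.card) : Set ℕ) by
        simp; omega)
      have hab' : (a, b) ∈ remCorner μ i h := by
        refine (mem_remCorner _ _ _ _).2 ⟨?_, hab⟩
        intro h5
        rw [Prod.mk.injEq] at h5
        obtain ⟨rfl, rfl⟩ := h5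
        simp only at hm2
        omega
      exact ⟨(a, b), hab', by simpa only [if_pos hab'] using hm2⟩

/-- Extend a tableau by adding the largest entry at the corner. -/
def SYT.extend {μ : YoungDiagram} (i : ℕ) (h : μ.rowLen (i + 1) < μ.rowLen i)
    (Q : SYT (remCorner μ i h)) : SYT μ where
  entry a b := if (a, b) = (i, μ.rowLen i - 1) then μ.card else Q.entry a b
  entry_eq_zero a b hab := by
    rw [if_neg, Q.entry_eq_zero]
    · intro h2; exact hab ((mem_remCorner _ _ _ _).1 h2).2
    · intro h2; rw [h2] at hab; exact hab (corner_mem μ i h)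
  row_strict a b c hbc hm := by
    have hpos := corner_card_pos μ i h
    have h1 : (a, b) ∈ μ := μ.up_left_mem le_rfl hbc.le hm
    have h2 : (a, b) ≠ (i, μ.rowLen i - 1) := by
      intro h3
      rw [Prod.mk.injEq] at h3
      obtain ⟨rfl, rfl⟩ := h3
      have := YoungDiagram.mem_iff_lt_rowLen.1 hm
      omega
    rw [if_neg h2]
    have h3 := Q.entry_mem ((mem_remCorner _ _ _ _).2 ⟨h2, h1⟩)
    rw [card_remCorner] at h3
    split_ifs with h4
    · omega
    · exact Q.row_strict _ _ _ hbc ((mem_remCorner _ _ _ _).2 ⟨h4, hm⟩)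
  col_strict a b c hbc hm := by
    have hpos := corner_card_pos μ i h
    have h1 : (a, c) ∈ μ := μ.up_left_mem hbc.le le_rfl hm
    have h2 : (a, c) ≠ (i, μ.rowLen i - 1) := by
      intro h3
      rw [Prod.mk.injEq] at h3
      obtain ⟨rfl, rfl⟩ := h3
      have := YoungDiagram.mem_iff_lt_rowLen.1 hm
      have h6 : μ.rowLen b ≤ μ.rowLen (a + 1) := μ.rowLen_anti _ _ (by omega)
      omega
    rw [if_neg h2]
    have h3 := Q.entry_mem ((mem_remCorner _ _ _ _).2 ⟨h2, h1⟩)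
    rw [card_remCorner] at h3
    split_ifs with h4
    · omega
    · exact Q.col_strict _ _ _ hbc ((mem_remCorner _ _ _ _).2 ⟨h4, hm⟩)
  bijOn := by
    have hpos := corner_card_pos μ i h
    have hlt : ∀ a b, (a, b) ∈ μ → (a, b) ≠ (i, μ.rowLen i - 1) →
        1 ≤ Q.entry a b ∧ Q.entry a b < μ.card := by
      intro a b h1 h2
      have h3 := Q.entry_mem ((mem_remCorner _ _ _ _).2 ⟨h2, h1⟩)
      rw [card_remCorner] at h3
      omega
    refine ⟨?_, ?_, ?_⟩
    · rintro ⟨a, b⟩ hab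
      simp only [Finset.coe_Icc, Set.mem_Icc]
      split_ifs with h4
      · omega
      · have := hlt a b hab h4
        omega
    · rintro ⟨a, b⟩ hab ⟨c, d⟩ hcd heq
      simp only at heq
      split_ifs at heq with h4 h5 h5
      · rw [h4, h5]
      · have := hlt c d hcd h5
        omega
      · have := hlt a b hab h4
        omega
      · exact Q.bijOn.injOn ((mem_remCorner _ _ _ _).2 ⟨h4, hab⟩)
          ((mem_remCorner _ _ _ _).2 ⟨h5, hcd⟩) heq
    · intro m hm
      simp only [Finset.coe_Icc, Set.mem_Icc] at hm
      by_cases hm2 : m = μ.card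
      · exact ⟨(i, μ.rowLen i - 1), corner_mem μ i h, by simp [hm2]⟩
      · obtain ⟨⟨a, b⟩, hab, hm3⟩ := Q.bijOn.surjOn
          (show m ∈ (↑(Finset.Icc 1 (remCorner μ i h).card) : Set ℕ) by
            rw [card_remCorner]; simp; omega)
        have hab' := (mem_remCorner _ _ _ _).1 (show (a, b) ∈ remCorner μ i h from hab)
        exact ⟨(a, b), hab'.2, by simpa only [if_neg hab'.1] using hm3⟩

lemma SYT.card_fiber {μ : YoungDiagram} (i : ℕ) (h : μ.rowLen (i + 1) < μ.rowLen i) :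
    Nat.card {Q : SYT μ // Q.entry i (μ.rowLen i - 1) = μ.card} =
      Nat.card (SYT (remCorner μ i h)) := by
  refine Nat.card_congr
    { toFun := fun Q => Q.1.restrict i h Q.2
      invFun := fun Q => ⟨Q.extend i h, by simp [SYT.extend]⟩
      left_inv := ?_
      right_inv := ?_ }
  · rintro ⟨Q, hQ⟩
    apply Subtype.ext
    refine SYT.ext' fun a b hab => ?_
    simp only [SYT.extend, SYT.restrict]
    split_ifs with h1 h2
    · rw [Prod.mk.injEq] at h1
      rw [h1.1, h1.2, hQ]
    · rfl
    · exact absurd ((mem_remCorner _ _ _ _).2 ⟨h1, hab⟩) h2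
  · intro Q
    refine SYT.ext' fun a b hab => ?_
    simp only [SYT.extend, SYT.restrict, if_pos hab, if_neg ((mem_remCorner _ _ _ _).1 hab).1]

/-- The position of the largest entry is a unique corner. -/
lemma SYT.exists_corner {μ : YoungDiagram} (hμ : 0 < μ.card) (Q : SYT μ) :
    ∃ i, μ.rowLen (i + 1) < μ.rowLen i ∧ Q.entry i (μ.rowLen i - 1) = μ.card := by
  obtain ⟨⟨a, b⟩, hab, hm⟩ := Q.bijOn.surjOn
    (show μ.card ∈ (↑(Finset.Icc 1 μ.card) : Set ℕ) by
      rw [Finset.coe_Icc, Set.mem_Icc]; omega)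
  have hab' : (a, b) ∈ μ := hab
  simp only at hm
  have hb := YoungDiagram.mem_iff_lt_rowLen.1 hab'
  have hb2 : b = μ.rowLen a - 1 := by
    by_contra hne
    have h1 : (a, b + 1) ∈ μ := YoungDiagram.mem_iff_lt_rowLen.2 (by omega)
    have h2 := Q.row_strict a b (b + 1) (by omega) h1
    have := Q.entry_mem h1
    omega
  refine ⟨a, ?_, hb2 ▸ hm⟩
  by_contra hle
  have h1 : (a + 1, b) ∈ μ := YoungDiagram.mem_iff_lt_rowLen.2 (by omega)
  have h2 := Q.col_strict a (a + 1) b (by omega) h1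
  have := Q.entry_mem h1
  omega

lemma SYT.card_rec {μ : YoungDiagram} (k : ℕ) (hk : μ.rowLen k = 0) (hμ : 0 < μ.card) :
    Nat.card (SYT μ) = ∑ i : Fin k, if h : μ.rowLen (i + 1) < μ.rowLen i then
      Nat.card (SYT (remCorner μ i h)) else 0 := by
  have := Fintype.ofFinite (SYT μ)
  have h1 : Nat.card (SYT μ) = ∑ i : Fin k, (Finset.univ.filter fun Q : SYT μ =>
      μ.rowLen (i + 1) < μ.rowLen i ∧ Q.entry i (μ.rowLen i - 1) = μ.card).card := by
    rw [Nat.card_eq_fintype_card, ← Finset.card_univ, ← Finset.card_biUnion]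
    · congr 1
      symm
      rw [Finset.eq_univ_iff_forall]
      intro Q
      obtain ⟨i, h1, h2⟩ := Q.exists_corner hμ
      have hi : i < k := by
        by_contra hik
        have := μ.rowLen_anti k i (by omega)
        omega
      simp only [Finset.mem_biUnion, Finset.mem_univ, Finset.mem_filter, true_and]
      exact ⟨⟨i, hi⟩, h1, h2⟩
    · intro i _ j _ hij
      rw [Function.onFun, Finset.disjoint_left]
      intro Q h1 h2
      simp only [Finset.mem_univ, Finset.mem_filter, true_and] at h1 h2
      have := Q.bijOn.injOn (corner_mem μ i h1.1) (corner_mem μ j h2.1) (h1.2.trans h2.2.symm)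
      rw [Prod.mk.injEq] at this
      exact hij (Fin.ext this.1)
  rw [h1]
  refine Finset.sum_congr rfl fun i _ => ?_
  split_ifs with h
  · rw [← SYT.card_fiber, Nat.card_eq_fintype_card, Fintype.card_subtype]
    simp [h]
  · simp [h]

lemma detD_eq_card_SYT (n k : ℕ) : ∀ (μ : YoungDiagram), μ.card = n → μ.rowLen k = 0 →
    detD k n (fun i => ((μ.rowLen (i : ℕ) : ℕ) : ℤ) - ((i : ℕ) : ℤ)) = (Nat.card (SYT μ) : ℤ) := by
  induction n with
  | zero =>
    intro μ hμ _
    have hmem : ∀ p, p ∉ μ := by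
      intro p hp
      have : 0 < μ.card := Finset.card_pos.2 ⟨p, hp⟩
      omega
    have h0 : ∀ i, μ.rowLen i = 0 := by
      intro i
      by_contra h
      exact hmem (i, 0) (YoungDiagram.mem_iff_lt_rowLen.2 (by omega))
    have h1 : Nat.card (SYT μ) = 1 := by
      rw [Nat.card_eq_one_iff_unique]
      refine ⟨⟨fun Q R => SYT.ext' fun i j h => absurd h (hmem _)⟩, ⟨?_⟩⟩
      exact
        { entry := fun _ _ => 0
          entry_eq_zero := fun _ _ _ => rfl
          row_strict := fun _ _ _ _ h => absurd h (hmem _)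
          col_strict := fun _ _ _ _ h => absurd h (hmem _)
          bijOn := by
            rw [hμ, Finset.card_eq_zero.1 hμ]
            simp }
    rw [h1]
    simp only [h0]
    simpa using detD_zero k
  | succ n ih =>
    intro μ hμ hk
    rw [detD_succ, SYT.card_rec k hk (by omega)]
    push_cast
    refine Finset.sum_congr rfl fun i _ => ?_
    split_ifs with h
    · rw [← ih (remCorner μ i h) (by rw [card_remCorner]; omega)
        (by rw [rowLen_remCorner, hk]; simp)]
      congr 1
      ext j
      rw [rowLen_remCorner]
      by_cases hj : j = i
      · subst hj
        simp
        omega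
      · simp [hj, Fin.val_inj]
    · by_cases hik : (i : ℕ) + 1 < k
      · have h2 := μ.rowLen_anti i (i + 1) (by omega)
        have hne : (⟨i + 1, hik⟩ : Fin k) ≠ i := by
          intro h3
          have := congrArg Fin.val h3
          simp at this
        rw [detD_eq_zero k n _ i ⟨i + 1, hik⟩ hne.symm]
        · simp
        · simp [hne]
          omega
      · have hik2 : (i : ℕ) + 1 = k := by have := i.2; omega
        rw [hik2, hk] at h
        rw [detD_neg k n _ i]
        · simp
        · simp; omega

lemma chi_one_eq (n : ℕ) (μ : YoungDiagram) (hμ : μ.card = n) :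
    chi n μ 1 = (Nat.card (SYT μ) : ℤ) := by
  rw [chi_one]
  refine detD_eq_card_SYT n _ μ hμ ?_
  by_contra h
  have h1 : (μ.rowLens.length, 0) ∈ μ := YoungDiagram.mem_iff_lt_rowLen.2 (by omega)
  rw [YoungDiagram.length_rowLens] at h1
  rw [YoungDiagram.mem_iff_lt_colLen] at h1
  omega

/-! ### Part C : maximal chains -/

lemma sublist_eq_filter {α : Type*} {l L : List α} (h : l.Sublist L) (hL : L.Nodup) :
    l = L.filter (fun a => decide (a ∈ l)) := by
  induction h with
  | slnil => rfl
  | @cons l₁ l₂ a h ih =>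
    have h2 := List.nodup_cons.1 hL
    have ha : a ∉ l₁ := fun h3 => h2.1 (h.subset h3)
    rw [List.filter_cons_of_neg (by simpa using ha)]
    exact ih h2.2
  | @cons_cons l₁ l₂ a h ih =>
    have h2 := List.nodup_cons.1 hL
    rw [List.filter_cons_of_pos (by simp)]
    congr 1
    conv_lhs => rw [ih h2.2]
    refine List.filter_congr fun x hx => ?_
    have : x ≠ a := fun h3 => h2.1 (h3 ▸ hx)
    simp [this]

lemma cword_length_le {n r : ℕ} (u : CInjWord n r) : u.1.length ≤ n := by
  have := u.2.length_le_card
  simpa using this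

lemma rkC_coe {n r : ℕ} (u : CInjWord n r) : rkC n r (u : WithTop (CInjWord n r)) = u.1.length :=
  rfl

lemma rkC_top {n r : ℕ} : rkC n r (⊤ : WithTop (CInjWord n r)) = n + 1 := rfl

lemma rkC_bot {n r : ℕ} : rkC n r (⊥ : WithTop (CInjWord n r)) = 0 := rfl

lemma cword_le {n r : ℕ} {u v : CInjWord n r} : u ≤ v ↔ u.1.Sublist v.1 := Iff.rfl

lemma rkC_eq_of_le {n r : ℕ} {x y : WithTop (CInjWord n r)} (h : x ≤ y)
    (h2 : rkC n r x = rkC n r y) : x = y := by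
  induction x using WithTop.recTopCoe with
  | top => exact (top_le_iff.1 h).symm
  | coe u =>
    induction y using WithTop.recTopCoe with
    | top =>
      rw [rkC_coe, rkC_top] at h2
      have := cword_length_le u
      omega
    | coe v =>
      rw [rkC_coe, rkC_coe] at h2
      have h3 := cword_le.1 (WithTop.coe_le_coe.1 h)
      rw [Subtype.ext (h3.eq_of_length h2)]

/-- The subword of the full word `(π, c)` at positions `w(1),…,w(t)`. -/
def subW {n r : ℕ} (π : Equiv.Perm (Fin n)) (c : Fin n → ZMod r) (w : Equiv.Perm (Fin n))
    (t : ℕ) : CInjWord n r :=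
  ⟨((List.finRange n).filter (fun i => decide (((w⁻¹ i : Fin n) : ℕ) < t))).map
      (fun i => (π i, c i)), by
    rw [List.map_map]
    exact ((List.nodup_finRange n).filter _).map π.injective⟩

lemma subW_length {n r : ℕ} (π : Equiv.Perm (Fin n)) (c : Fin n → ZMod r)
    (w : Equiv.Perm (Fin n)) (t : ℕ) (ht : t ≤ n) : (subW π c w t).1.length = t := by
  unfold subW
  simp only [List.length_map]
  rw [← List.toFinset_card_of_nodup ((List.nodup_finRange n).filter _)]
  have : ((List.finRange n).filter (fun i => decide (((w⁻¹ i : Fin n) : ℕ) < t))).toFinset =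
      (Finset.univ.filter fun j : Fin n => (j : ℕ) < t).map w.toEmbedding := by
    ext i
    simp [Equiv.Perm.inv_def]
  rw [this, Finset.card_map, Fin.card_filter_val_lt]
  omega

lemma subW_mono {n r : ℕ} (π : Equiv.Perm (Fin n)) (c : Fin n → ZMod r)
    (w : Equiv.Perm (Fin n)) {s t : ℕ} (h : s ≤ t) : subW π c w s ≤ subW π c w t := by
  rw [cword_le]
  refine List.Sublist.map _ (List.monotone_filter_right _ ?_)
  intro a ha
  simp only [decide_eq_true_eq] at ha ⊢
  omega

/-- The chain associated to a colored permutation and a permutation `w`. -/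
def chainOf {n r : ℕ} (T : Finset ℕ) (π : Equiv.Perm (Fin n)) (c : Fin n → ZMod r)
    (w : Equiv.Perm (Fin n)) : Set (WithTop (CInjWord n r)) :=
  {x | x = ⊥ ∨ x = ⊤ ∨ ∃ t ∈ insert n T, x = (subW π c w t : WithTop (CInjWord n r))}

lemma chainOf_isChain {n r : ℕ} (T : Finset ℕ) (π : Equiv.Perm (Fin n)) (c : Fin n → ZMod r)
    (w : Equiv.Perm (Fin n)) : IsChain (· ≤ ·) (chainOf T π c w) := by
  rintro x hx y hy -
  rcases hx with rfl | rfl | ⟨s, hs, rfl⟩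
  · exact Or.inl bot_le
  · exact Or.inr le_top
  · rcases hy with rfl | rfl | ⟨t, ht, rfl⟩
    · exact Or.inr bot_le
    · exact Or.inl le_top
    · rcases le_total s t with h | h
      · exact Or.inl (WithTop.coe_le_coe.2 (subW_mono π c w h))
      · exact Or.inr (WithTop.coe_le_coe.2 (subW_mono π c w h))

lemma le_of_mem_insert {n : ℕ} {T : Finset ℕ} (hT : T ⊆ Finset.Icc 1 (n - 1)) (hn : 0 < n) {t : ℕ}
    (ht : t ∈ insert n T) : 1 ≤ t ∧ t ≤ n := by
  rcases Finset.mem_insert.1 ht with rfl | h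
  · omega
  · have := Finset.mem_Icc.1 (hT h)
    omega

lemma chainOf_max {n r : ℕ} (hn : 0 < n) (T : Finset ℕ) (hT : T ⊆ Finset.Icc 1 (n - 1))
    (π : Equiv.Perm (Fin n)) (c : Fin n → ZMod r)
    (w : Equiv.Perm (Fin n)) : chainOf T π c w ∈ maxChainsIn (rankSel (rkC n r) (insert n T)) := by
  have hrk : ∀ t ∈ insert n T, rkC n r (subW π c w t : WithTop (CInjWord n r)) = t := by
    intro t ht
    rw [rkC_coe, subW_length π c w t (le_of_mem_insert hT hn ht).2]
  refine ⟨?_, chainOf_isChain T π c w, ?_⟩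
  · rintro x (rfl | rfl | ⟨t, ht, rfl⟩)
    · right; simp
    · right; simp
    · left
      rw [Set.mem_ofPred_eq, hrk t ht]
      exact ht
  · intro D hD hDc hCD
    refine Set.Subset.antisymm hCD ?_
    intro y hy
    rcases hD hy with h | h | h
    · have hm : (subW π c w (rkC n r y) : WithTop (CInjWord n r)) ∈ chainOf T π c w :=
        Or.inr (Or.inr ⟨_, h, rfl⟩)
      have h2 := hrk _ h
      rcases hDc.total hy (hCD hm) with h3 | h3
      · rw [rkC_eq_of_le h3 h2.symm]; exact hm
      · rw [← rkC_eq_of_le h3 h2]; exact hm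
    · exact Or.inl h
    · exact Or.inr (Or.inl h)

lemma exists_full {n r : ℕ} (u : CInjWord n r) :
    ∃ (π : Equiv.Perm (Fin n)) (c : Fin n → ZMod r),
      u.1.Sublist ((List.finRange n).map (fun i => (π i, c i))) := by
  let x : List (Fin n × ZMod r) := u.1 ++
    ((List.finRange n).filter (fun i => decide (i ∉ u.1.map Prod.fst))).map (fun i => (i, 0))
  have hx1 : (x.map Prod.fst) = u.1.map Prod.fst ++
      ((List.finRange n).filter (fun i => decide (i ∉ u.1.map Prod.fst))) := by
    simp only [x, List.map_append, List.map_map]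
    congr 1
    exact List.map_id _
  have hnd : (x.map Prod.fst).Nodup := by
    rw [hx1, List.nodup_append']
    refine ⟨u.2, (List.nodup_finRange n).filter _, ?_⟩
    intro a h1 h2
    have := (List.mem_filter.1 h2).2
    simp only [decide_eq_true_eq] at this
    exact this h1
  have hlen : x.length = n := by
    have h1 : (x.map Prod.fst).toFinset = Finset.univ := by
      rw [Finset.eq_univ_iff_forall]
      intro i
      rw [List.mem_toFinset, hx1, List.mem_append, List.mem_filter]
      by_cases h : i ∈ u.1.map Prod.fst
      · exact Or.inl h
      · exact Or.inr ⟨List.mem_finRange i, by simpa using h⟩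
    have h2 := List.toFinset_card_of_nodup hnd
    rw [h1] at h2
    simpa using h2.symm
  have hinj : Function.Injective (fun i : Fin n => (x.get (Fin.cast hlen.symm i)).1) := by
    intro i j hij
    have h2 := List.nodup_iff_injective_get.1 hnd
      (a₁ := Fin.cast (by simp [hlen]) i) (a₂ := Fin.cast (by simp [hlen]) j) (by simpa using hij)
    have := congrArg Fin.val h2
    exact Fin.ext (by simpa using this)
  refine ⟨Equiv.ofBijective _ (Finite.injective_iff_bijective.1 hinj),
    fun i => (x.get (Fin.cast hlen.symm i)).2, ?_⟩
  have : (List.finRange n).map (fun i =>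
      ((Equiv.ofBijective _ (Finite.injective_iff_bijective.1 hinj)) i,
        (x.get (Fin.cast hlen.symm i)).2)) = x := by
    apply List.ext_getElem
    · simp [hlen]
    · intro i h1 h2
      simp
  rw [this]
  exact List.sublist_append_left _ _

lemma exists_chainOf {n r : ℕ} (T : Finset ℕ)
    (C : Set (WithTop (CInjWord n r))) (hC : IsChain (· ≤ ·) C)
    (hCA : C ⊆ rankSel (rkC n r) (insert n T)) :
    ∃ (π : Equiv.Perm (Fin n)) (c : Fin n → ZMod r) (w : Equiv.Perm (Fin n)),
      descentSet w ⊆ T ∧ C ⊆ chainOf T π c w := by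
  -- a largest word of the chain
  obtain ⟨u, hu⟩ : ∃ u : CInjWord n r, ∀ y : CInjWord n r,
      (y : WithTop (CInjWord n r)) ∈ C → y ≤ u := by
    by_cases hne : ∃ y : CInjWord n r, (y : WithTop (CInjWord n r)) ∈ C
    · let P : ℕ → Prop := fun m => ∃ y : CInjWord n r,
        (y : WithTop (CInjWord n r)) ∈ C ∧ y.1.length = m
      obtain ⟨y, hy⟩ := hne
      have hP : P (Nat.findGreatest P n) :=
        Nat.findGreatest_spec (cword_length_le y) ⟨y, hy, rfl⟩
      obtain ⟨u, hu, hum⟩ := hP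
      refine ⟨u, fun z hz => ?_⟩
      have h1 : z.1.length ≤ Nat.findGreatest P n :=
        Nat.le_findGreatest (cword_length_le z) ⟨z, hz, rfl⟩
      rcases hC.total hz hu with h | h
      · exact WithTop.coe_le_coe.1 h
      · have h2 := cword_le.1 (WithTop.coe_le_coe.1 h)
        have := h2.length_le
        exact le_of_eq (Subtype.ext (h2.eq_of_length (by omega))).symm
    · exact ⟨⊥, fun y hy => absurd ⟨y, hy⟩ hne⟩
  obtain ⟨π, c, hx⟩ := exists_full u
  set p : Fin n → Fin n × ZMod r := fun i => (π i, c i) with hp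
  have hpinj : Function.Injective p := fun i j h => π.injective (congrArg Prod.fst h)
  have hsub : ∀ y : CInjWord n r, (y : WithTop (CInjWord n r)) ∈ C →
      y.1 = ((List.finRange n).filter (fun i => decide (p i ∈ y.1))).map p := by
    intro y hy
    have h1 : y.1.Sublist ((List.finRange n).map p) := (cword_le.1 (hu y hy)).trans hx
    conv_lhs => rw [sublist_eq_filter h1 ((List.nodup_finRange n).map hpinj)]
    rw [List.filter_map]
    congr 1
    refine List.filter_congr fun i _ => ?_
    simp [Function.comp]
  have hcomp : ∀ y z : CInjWord n r, (y : WithTop (CInjWord n r)) ∈ C →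
      (z : WithTop (CInjWord n r)) ∈ C → y.1.Sublist z.1 ∨ z.1.Sublist y.1 := by
    intro y z hy hz
    rcases hC.total hy hz with h | h
    · exact Or.inl (cword_le.1 (WithTop.coe_le_coe.1 h))
    · exact Or.inr (cword_le.1 (WithTop.coe_le_coe.1 h))
  let H : Fin n → Finset ℕ := fun i => (Finset.range (n + 1)).filter fun t =>
    ∃ y : CInjWord n r, (y : WithTop (CInjWord n r)) ∈ C ∧ y.1.length = t ∧ p i ∉ y.1
  let h : Fin n → ℕ := fun i => (H i).card
  have hlt : ∀ (y : CInjWord n r) (i j : Fin n), (y : WithTop (CInjWord n r)) ∈ C →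
      p i ∈ y.1 → p j ∉ y.1 → h i < h j := by
    intro y i j hy hi hj
    apply Finset.card_lt_card
    rw [Finset.ssubset_iff_of_subset]
    · refine ⟨y.1.length, ?_, ?_⟩
      · exact Finset.mem_filter.2 ⟨Finset.mem_range.2 (Nat.lt_succ_of_le (cword_length_le y)),
          y, hy, rfl, hj⟩
      · intro hm
        obtain ⟨_, z, hz, hzl, hzi⟩ := Finset.mem_filter.1 hm
        have : z.1 = y.1 := by
          rcases hcomp y z hy hz with h1 | h1
          · exact (h1.eq_of_length hzl.symm).symm
          · exact h1.eq_of_length hzl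
        rw [this] at hzi
        exact hzi hi
    · intro t ht
      obtain ⟨ht1, z, hz, hzl, hzi⟩ := Finset.mem_filter.1 ht
      refine Finset.mem_filter.2 ⟨ht1, z, hz, hzl, ?_⟩
      intro hzj
      rcases hcomp y z hy hz with h1 | h1
      · exact hzi (h1.subset hi)
      · exact hj (h1.subset hzj)
  obtain ⟨hmono, hstable⟩ := (Tuple.eq_sort_iff (f := h) (σ := Tuple.sort h)).1 rfl
  set w := Tuple.sort h with hw
  -- each word in `C` is an initial segment in the order given by `w`
  have hseg : ∀ y : CInjWord n r, (y : WithTop (CInjWord n r)) ∈ C →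
      ∀ j : Fin n, p (w j) ∈ y.1 ↔ (j : ℕ) < y.1.length := by
    intro y hy
    have hlow : ∀ i j : Fin n, i ≤ j → p (w j) ∈ y.1 → p (w i) ∈ y.1 := by
      intro i j hij hj
      by_contra hi
      have h1 := hlt y _ _ hy hj hi
      have h2 := hmono hij
      simp only [Function.comp] at h2
      omega
    have hcard : (Finset.univ.filter fun j : Fin n => p (w j) ∈ y.1).card = y.1.length := by
      conv_rhs => rw [hsub y hy]
      rw [List.length_map, ← List.toFinset_card_of_nodup ((List.nodup_finRange n).filter _),
        ← Finset.card_map w.toEmbedding]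
      congr 1
      ext i
      simp only [Finset.mem_map_equiv, Finset.mem_filter, Finset.mem_univ, true_and,
        Equiv.apply_symm_apply, List.mem_toFinset, List.mem_filter, List.mem_finRange,
        decide_eq_true_eq]
    intro j
    constructor
    · intro hj
      have hs : (Finset.Iic j) ⊆ (Finset.univ.filter fun j : Fin n => p (w j) ∈ y.1) := by
        intro i hi
        exact Finset.mem_filter.2 ⟨Finset.mem_univ _, hlow i j (Finset.mem_Iic.1 hi) hj⟩
      have := Finset.card_le_card hs
      rw [hcard, Fin.card_Iic] at this
      omega
    · intro hj
      by_contra hnot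
      have hs : (Finset.univ.filter fun j : Fin n => p (w j) ∈ y.1) ⊆ Finset.Iio j := by
        intro i hi
        rw [Finset.mem_Iio]
        by_contra hij
        exact hnot (hlow j i (not_lt.1 hij) (Finset.mem_filter.1 hi).2)
      have := Finset.card_le_card hs
      rw [hcard, Fin.card_Iio] at this
      omega
  refine ⟨π, c, w, ?_, ?_⟩
  · intro d hd
    obtain ⟨hd1, hd2⟩ := Finset.mem_filter.1 hd
    rw [Finset.mem_Icc] at hd1
    have e1 : d - 1 < n := by omega
    have e2 : d < n := by omega
    unfold permApp at hd2
    rw [dif_pos (show d + 1 - 1 < n by omega), dif_pos e1] at hd2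
    simp only [Nat.add_sub_cancel] at hd2
    have hle : h (w ⟨d - 1, e1⟩) ≤ h (w ⟨d, e2⟩) :=
      hmono (show (⟨d - 1, e1⟩ : Fin n) ≤ ⟨d, e2⟩ from Fin.mk_le_mk.2 (by omega))
    have hne : h (w ⟨d - 1, e1⟩) ≠ h (w ⟨d, e2⟩) := by
      intro h1
      have h2 := hstable _ _ (show (⟨d - 1, e1⟩ : Fin n) < ⟨d, e2⟩ from
        Fin.mk_lt_mk.2 (by omega)) h1
      have h3 : ((w ⟨d - 1, e1⟩ : Fin n) : ℕ) < (w ⟨d, e2⟩ : Fin n) := h2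
      omega
    obtain ⟨t, ht1, ht2⟩ : ∃ t ∈ H (w ⟨d, e2⟩), t ∉ H (w ⟨d - 1, e1⟩) := by
      by_contra hcon
      push Not at hcon
      have := Finset.card_le_card (show H (w ⟨d, e2⟩) ⊆ H (w ⟨d - 1, e1⟩) from hcon)
      simp only [h] at hle hne
      omega
    obtain ⟨ht0, y, hy, hyl, hyd⟩ := Finset.mem_filter.1 ht1
    have hyd1 : p (w ⟨d - 1, e1⟩) ∈ y.1 := by
      by_contra hnot
      exact ht2 (Finset.mem_filter.2 ⟨ht0, y, hy, hyl, hnot⟩)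
    rw [hseg y hy] at hyd hyd1
    simp only at hyd hyd1
    have hyl2 : y.1.length = d := by omega
    rcases hCA hy with h1 | h1 | h1
    · rw [Set.mem_ofPred_eq, rkC_coe, hyl2] at h1
      rcases Finset.mem_insert.1 h1 with h2 | h2
      · omega
      · exact h2
    · have := congrArg (rkC n r) h1
      rw [rkC_coe, rkC_bot] at this
      omega
    · have := congrArg (rkC n r) h1
      rw [rkC_coe, rkC_top] at this
      omega
  · intro z hz
    induction z using WithTop.recTopCoe with
    | top => exact Or.inr (Or.inl rfl)
    | coe y =>
      rcases hCA hz with h1 | h1 | h1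
      · refine Or.inr (Or.inr ⟨y.1.length, h1, ?_⟩)
        congr 1
        apply Subtype.ext
        conv_lhs => rw [hsub y hz]
        unfold subW
        simp only
        congr 1
        refine List.filter_congr fun i _ => ?_
        congr 1
        apply propext
        rw [← hseg y hz]
        simp
      · exact Or.inl h1
      · exact Or.inr (Or.inl h1)

lemma eq_sort_of_descent {n : ℕ} (T : Finset ℕ) (w : Equiv.Perm (Fin n)) (hw : descentSet w ⊆ T) :
    w = Tuple.sort (fun i : Fin n => (T.filter fun t => t ≤ ((w⁻¹ i : Fin n) : ℕ)).card) := by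
  have hinv : ∀ i, w⁻¹ (w i) = i := fun i => w.symm_apply_apply i
  rw [Tuple.eq_sort_iff]
  constructor
  · intro i j hij
    simp only [Function.comp, hinv]
    apply Finset.card_le_card
    intro t ht
    rw [Finset.mem_filter] at ht ⊢
    exact ⟨ht.1, ht.2.trans hij⟩
  · intro i j hij heq
    simp only [hinv] at heq
    have hnot : ∀ t ∈ T, t ≤ (j : ℕ) → t ≤ (i : ℕ) := by
      intro t ht htj
      have hs : (T.filter fun t => t ≤ (i : ℕ)) ⊆ (T.filter fun t => t ≤ (j : ℕ)) := by
        intro t ht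
        rw [Finset.mem_filter] at ht ⊢
        exact ⟨ht.1, ht.2.trans (le_of_lt hij)⟩
      have := Finset.eq_of_subset_of_card_le hs heq.symm.le
      have h2 : t ∈ (T.filter fun t => t ≤ (j : ℕ)) := Finset.mem_filter.2 ⟨ht, htj⟩
      rw [← this] at h2
      exact (Finset.mem_filter.1 h2).2
    have key : ∀ m : ℕ, ∀ hm : (i : ℕ) + 1 + m < n, (i : ℕ) + 1 + m ≤ j →
        w i < w ⟨(i : ℕ) + 1 + m, hm⟩ := by
      have step : ∀ d (e1 : d < n) (e2 : d + 1 < n), (i : ℕ) ≤ d → d + 1 ≤ (j : ℕ) →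
          w ⟨d, e1⟩ < w ⟨d + 1, e2⟩ := by
        intro d e1 e2 hd1 hd2
        by_contra hcon
        have hne : w ⟨d, e1⟩ ≠ w ⟨d + 1, e2⟩ := by
          intro h1
          have := congrArg Fin.val (w.injective h1)
          simp at this
        have hlt : w ⟨d + 1, e2⟩ < w ⟨d, e1⟩ := lt_of_le_of_ne (not_lt.1 hcon) hne.symm
        have hmem : d + 1 ∈ descentSet w := by
          refine Finset.mem_filter.2 ⟨Finset.mem_Icc.2 ⟨by omega, by omega⟩, ?_⟩
          unfold permApp
          rw [dif_pos (show d + 1 + 1 - 1 < n by omega), dif_pos (show d + 1 - 1 < n by omega)]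
          simp only [Nat.add_sub_cancel]
          exact Nat.succ_lt_succ hlt
        have := hnot _ (hw hmem) hd2
        omega
      intro m
      induction m with
      | zero =>
        intro hm hj
        exact step i i.2 hm le_rfl hj
      | succ m ih =>
        intro hm hj
        exact (ih (by omega) (by omega)).trans (step (i + 1 + m) (by omega) hm (by omega) hj)
    have h3 : (i : ℕ) < j := hij
    have h4 := key (j - i - 1) (by have := j.2; omega) (by omega)
    have h5 : (⟨(i : ℕ) + 1 + (j - i - 1), by have := j.2; omega⟩ : Fin n) = j := by
      apply Fin.ext
      simp only
      omega
    rwa [h5] at h4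

lemma chainOf_word_eq {n r : ℕ} (hn : 0 < n) (T : Finset ℕ) (hT : T ⊆ Finset.Icc 1 (n - 1))
    {π : Equiv.Perm (Fin n)} {c : Fin n → ZMod r} {w : Equiv.Perm (Fin n)} {u : CInjWord n r}
    (hu : (u : WithTop (CInjWord n r)) ∈ chainOf T π c w) {t : ℕ} (ht : t ∈ insert n T)
    (hut : u.1.length = t) : u = subW π c w t := by
  have h1 := le_of_mem_insert hT hn ht
  rcases hu with h | h | ⟨s, hs, h⟩
  · have := congrArg (rkC n r) h
    rw [rkC_coe, rkC_bot] at this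
    omega
  · have := congrArg (rkC n r) h
    rw [rkC_coe, rkC_top] at this
    omega
  · have := congrArg (rkC n r) h
    rw [rkC_coe, rkC_coe, subW_length _ _ _ _ (le_of_mem_insert hT hn hs).2] at this
    rw [WithTop.coe_inj.1 h]
    congr 1
    omega

lemma subW_mem {n r : ℕ} (T : Finset ℕ) (π : Equiv.Perm (Fin n)) (c : Fin n → ZMod r)
    (w : Equiv.Perm (Fin n)) {t : ℕ} (ht : t ∈ insert n T) :
    (subW π c w t : WithTop (CInjWord n r)) ∈ chainOf T π c w := Or.inr (Or.inr ⟨t, ht, rfl⟩)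

lemma subW_full {n r : ℕ} (π : Equiv.Perm (Fin n)) (c : Fin n → ZMod r)
    (w : Equiv.Perm (Fin n)) :
    (subW π c w n).1 = (List.finRange n).map (fun i => (π i, c i)) := by
  unfold subW
  simp

lemma chainOf_inj {n r : ℕ} (hn : 0 < n) (T : Finset ℕ) (hT : T ⊆ Finset.Icc 1 (n - 1))
    {π π' : Equiv.Perm (Fin n)} {c c' : Fin n → ZMod r} {w w' : Equiv.Perm (Fin n)}
    (hw : descentSet w ⊆ T) (hw' : descentSet w' ⊆ T)
    (h : chainOf T π c w = chainOf T π' c' w') : π = π' ∧ c = c' ∧ w = w' := by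
  have hword : ∀ t ∈ insert n T, subW π c w t = subW π' c' w' t := by
    intro t ht
    refine chainOf_word_eq hn T hT (h ▸ subW_mem T π c w ht) ht ?_
    exact subW_length _ _ _ _ (le_of_mem_insert hT hn ht).2
  have hfull := congrArg Subtype.val (hword n (Finset.mem_insert_self _ _))
  rw [subW_full, subW_full, List.map_inj_left] at hfull
  have hπ : π = π' := by
    ext i
    exact congrArg (fun q : Fin n × ZMod r => (q.1 : ℕ)) (hfull i (List.mem_finRange i))
  have hc : c = c' := by
    ext i
    exact congrArg Prod.snd (hfull i (List.mem_finRange i))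
  refine ⟨hπ, hc, ?_⟩
  subst hπ hc
  rw [eq_sort_of_descent T w hw, eq_sort_of_descent T w' hw']
  congr 1
  ext i
  congr 1
  refine Finset.filter_congr fun t ht => ?_
  have h1 := congrArg Subtype.val (hword t (Finset.mem_insert_of_mem ht))
  unfold subW at h1
  have hpinj : Function.Injective (fun i => (π i, c i)) :=
    fun i j h => π.injective (congrArg Prod.fst h)
  have h2 := List.map_injective_iff.2 hpinj h1
  have h3 : i ∈ (List.finRange n).filter (fun i => decide (((w⁻¹ i : Fin n) : ℕ) < t)) ↔
      i ∈ (List.finRange n).filter (fun i => decide (((w'⁻¹ i : Fin n) : ℕ) < t)) := by rw [h2]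
  simp only [List.mem_filter, List.mem_finRange, true_and, decide_eq_true_eq] at h3
  omega

lemma mem_maxChains_iff {n r : ℕ} (hn : 0 < n) (T : Finset ℕ) (hT : T ⊆ Finset.Icc 1 (n - 1))
    (C : Set (WithTop (CInjWord n r))) :
    C ∈ maxChainsIn (rankSel (rkC n r) (insert n T)) ↔
      ∃ (π : Equiv.Perm (Fin n)) (c : Fin n → ZMod r) (w : Equiv.Perm (Fin n)),
      descentSet w ⊆ T ∧ C = chainOf T π c w := by
  constructor
  · rintro ⟨h1, h2, h3⟩
    obtain ⟨π, c, w, hw, hC⟩ := exists_chainOf T C h2 h1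
    obtain ⟨g1, g2, -⟩ := chainOf_max (r := r) hn T hT π c w
    exact ⟨π, c, w, hw, h3 _ g1 g2 hC⟩
  · rintro ⟨π, c, w, hw, rfl⟩
    exact chainOf_max hn T hT π c w

lemma permCWord_one {n r : ℕ} (u : CInjWord n r) : permCWord 1 u = u := by
  apply Subtype.ext
  simp [permCWord]

lemma cAlpha_one (n r : ℕ) (hn : 0 < n) (T : Finset ℕ) (hT : T ⊆ Finset.Icc 1 (n - 1)) :
    cAlpha n r (insert n T) 1 = (n.factorial : ℤ) * (r : ℤ) ^ n *
      (Nat.card {w : Equiv.Perm (Fin n) // descentSet w ⊆ T} : ℤ) := by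
  unfold cAlpha gAlpha
  have hact : WithTop.map (permCWord (n := n) (r := r) 1) = id := by
    funext x
    induction x using WithTop.recTopCoe with
    | top => rfl
    | coe u => rw [WithTop.map_coe, permCWord_one]; rfl
  let F : Equiv.Perm (Fin n) × (Fin n → ZMod r) × {w : Equiv.Perm (Fin n) // descentSet w ⊆ T} →
      Set (WithTop (CInjWord n r)) := fun q => chainOf T q.1 q.2.1 q.2.2.1
  have hF : Function.Injective F := by
    rintro ⟨π, c, w, hw⟩ ⟨π', c', w', hw'⟩ h
    obtain ⟨rfl, rfl, rfl⟩ := chainOf_inj hn T hT hw hw' h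
    rfl
  have hset : {C : Set (WithTop (CInjWord n r)) |
      C ∈ maxChainsIn (rankSel (rkC n r) (insert n T)) ∧
        WithTop.map (permCWord (n := n) (r := r) 1) '' C = C} = Set.range F := by
    ext C
    rw [Set.mem_ofPred_eq, hact, Set.image_id, mem_maxChains_iff hn T hT]
    constructor
    · rintro ⟨⟨π, c, w, hw, rfl⟩, -⟩
      exact ⟨(π, c, ⟨w, hw⟩), rfl⟩
    · rintro ⟨⟨π, c, w, hw⟩, rfl⟩
      exact ⟨⟨π, c, w, hw, rfl⟩, rfl⟩
  rw [hset, ← Set.image_univ, Set.ncard_image_of_injective _ hF, Set.ncard_univ, Nat.card_prod,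
    Nat.card_prod, Nat.card_fun, Nat.card_zmod, Nat.card_perm, Nat.card_fin]
  push_cast
  ring

lemma cAlpha_ne_one (n r : ℕ) (hn : 0 < n) (T : Finset ℕ) (hT : T ⊆ Finset.Icc 1 (n - 1))
    (g : Equiv.Perm (Fin n)) (hg : g ≠ 1) : cAlpha n r (insert n T) g = 0 := by
  unfold cAlpha gAlpha
  have hset : {C : Set (WithTop (CInjWord n r)) |
      C ∈ maxChainsIn (rankSel (rkC n r) (insert n T)) ∧
        WithTop.map (permCWord (n := n) (r := r) g) '' C = C} = ∅ := by
    rw [Set.eq_empty_iff_forall_notMem]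
    rintro C ⟨hC, hgC⟩
    obtain ⟨π, c, w, hw, rfl⟩ := (mem_maxChains_iff hn T hT C).1 hC
    have hmem := subW_mem (r := r) T π c w (Finset.mem_insert_self n T)
    have h1 : ((permCWord g (subW π c w n) : CInjWord n r) : WithTop (CInjWord n r)) ∈
        chainOf T π c w := by
      rw [← hgC]
      exact ⟨_, hmem, rfl⟩
    have h2 := chainOf_word_eq hn T hT h1 (Finset.mem_insert_self n T) (by
      simp only [permCWord, List.length_map]
      exact subW_length _ _ _ _ le_rfl)
    have h3 := congrArg Subtype.val h2
    simp only [permCWord] at h3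
    rw [subW_full, List.map_map, List.map_inj_left] at h3
    apply hg
    ext i
    have h4 := congrArg Prod.fst (h3 (π⁻¹ i) (List.mem_finRange _))
    simp at h4
    simp [h4]
  rw [hset]
  simp

/-! ### Part D : inclusion-exclusion and conclusion -/

lemma incl_excl_aux (S D : Finset ℕ) :
    (∑ T ∈ S.powerset, (-1 : ℤ) ^ (S.card - T.card) * (if D ⊆ T then 1 else 0)) =
      if D = S then 1 else 0 := by
  by_cases hDS : D ⊆ S
  · have h := Finset.prod_add (fun _ : ℕ => (1 : ℤ)) (fun i => if i ∈ D then 0 else -1) S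
    have hl : (∏ i ∈ S, ((1 : ℤ) + if i ∈ D then 0 else -1)) = if D = S then 1 else 0 := by
      split_ifs with h1
      · subst h1
        refine Finset.prod_eq_one fun i hi => ?_
        simp [hi]
      · obtain ⟨i, hi, hiD⟩ := Finset.exists_of_ssubset (Finset.ssubset_iff_subset_ne.2 ⟨hDS, h1⟩)
        refine Finset.prod_eq_zero hi ?_
        simp [hiD]
    rw [← hl, h]
    refine Finset.sum_congr rfl fun T hT => ?_
    have hTS := Finset.mem_powerset.1 hT
    rw [Finset.prod_const_one, one_mul]
    split_ifs with h2
    · rw [mul_one, ← Finset.card_sdiff_of_subset hTS, ← Finset.prod_const]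
      refine Finset.prod_congr rfl fun i hi => ?_
      rw [if_neg]
      intro h3
      exact (Finset.mem_sdiff.1 hi).2 (h2 h3)
    · obtain ⟨i, hiD, hiT⟩ := Finset.not_subset.1 h2
      rw [mul_zero, Finset.prod_eq_zero (Finset.mem_sdiff.2 ⟨hDS hiD, hiT⟩)]
      simp [hiD]
  · rw [if_neg (fun h => hDS h.subset)]
    refine Finset.sum_eq_zero fun T hT => ?_
    rw [if_neg, mul_zero]
    intro h
    exact hDS (h.trans (Finset.mem_powerset.1 hT))

lemma incl_excl (n : ℕ) (S : Finset ℕ) :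
    (∑ T ∈ S.powerset, (-1 : ℤ) ^ (S.card - T.card) *
      (Nat.card {w : Equiv.Perm (Fin n) // descentSet w ⊆ T} : ℤ)) = numDescentSet n S := by
  have h1 : ∀ T : Finset ℕ, (Nat.card {w : Equiv.Perm (Fin n) // descentSet w ⊆ T} : ℤ) =
      ∑ w : Equiv.Perm (Fin n), if descentSet w ⊆ T then 1 else 0 := by
    intro T
    rw [Nat.card_eq_fintype_card, Fintype.card_subtype, Finset.card_filter]
    push_cast
    rfl
  have h2 : (numDescentSet n S : ℤ) =
      ∑ w : Equiv.Perm (Fin n), if descentSet w = S then 1 else 0 := by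
    unfold numDescentSet
    rw [Nat.card_eq_fintype_card, Fintype.card_subtype, Finset.card_filter]
    push_cast
    rfl
  rw [h2]
  simp only [h1, Finset.mul_sum]
  rw [Finset.sum_comm]
  exact Finset.sum_congr rfl fun w _ => incl_excl_aux S (descentSet w)

lemma cBeta_add (n r : ℕ) (S : Finset ℕ) (hnS : n ∉ S) (g : Equiv.Perm (Fin n)) :
    cBeta n r S g + cBeta n r (insert n S) g =
      ∑ T ∈ S.powerset, (-1 : ℤ) ^ (S.card - T.card) * cAlpha n r (insert n T) g := by
  unfold cBeta gBeta cAlpha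
  rw [Finset.sum_powerset_insert hnS, ← add_assoc, ← Finset.sum_add_distrib]
  rw [Finset.sum_eq_zero, zero_add]
  · refine Finset.sum_congr rfl fun T hT => ?_
    have hTS := Finset.mem_powerset.1 hT
    rw [Finset.card_insert_of_notMem hnS, Finset.card_insert_of_notMem (fun h => hnS (hTS h)),
      Nat.add_sub_add_right]
  · intro T hT
    have hTS := Finset.card_le_card (Finset.mem_powerset.1 hT)
    rw [Finset.card_insert_of_notMem hnS, Nat.sub_add_comm hTS, pow_succ]
    ring

end


/-- **Eq. (11)**: for the `𝔖_n`-action on the poset of `r`-colored injective words,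
`b_{r,λ}(S) + b_{r,λ}(S ∪ {n}) = b_n(S) · r^n · f^λ` for all `S ⊆ {1,…,n-1}` and all
partitions `λ` of `n`.  (The multiplicity `M` of `ρ^λ` in a virtual representation with
character `φ` is characterized by `Σ_g φ(g) χ^λ(g⁻¹) = M * n!`.) -/
theorem statement7 (n r : ℕ) (hn : 0 < n) (hr : 0 < r) (μ : YoungDiagram)
    (hμ : μ.card = n) (S : Finset ℕ) (hS : S ⊆ Finset.Icc 1 (n - 1)) :
    (∑ g : Equiv.Perm (Fin n),
        (cBeta n r S g + cBeta n r (insert n S) g) * chi n μ g⁻¹) =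
      (numDescentSet n S : ℤ) * (r : ℤ) ^ n * (Nat.card (SYT μ) : ℤ) *
        (n.factorial : ℤ) := by
  have hnS : n ∉ S := by
    intro h
    have := Finset.mem_Icc.1 (hS h)
    omega
  rw [Finset.sum_eq_single 1]
  · rw [inv_one, chi_one_eq n μ hμ, cBeta_add n r S hnS, ← incl_excl]
    have : (∑ T ∈ S.powerset, (-1 : ℤ) ^ (S.card - T.card) * cAlpha n r (insert n T) 1) =
        (n.factorial : ℤ) * (r : ℤ) ^ n * ∑ T ∈ S.powerset, (-1 : ℤ) ^ (S.card - T.card) *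
      (Nat.card {w : Equiv.Perm (Fin n) // descentSet w ⊆ T} : ℤ) := by
      rw [Finset.mul_sum]
      refine Finset.sum_congr rfl fun T hT => ?_
      rw [cAlpha_one n r hn T ((Finset.mem_powerset.1 hT).trans hS)]
      ring
    rw [this]
    ring
  · intro g _ hg
    rw [cBeta_add n r S hnS, Finset.sum_eq_zero, zero_mul]
    intro T hT
    rw [cAlpha_ne_one n r hn T ((Finset.mem_powerset.1 hT).trans hS) g hg, mul_zero]
  · simp
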